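/- Let λ = (λ_1 ≥ ⋯ ≥ λ_n ≥ 0) be a decreasing tuple of natural numbers and let u ∈ N(F) be an upper triangular unipotent matrix over F such that the lattice u·ϖ^λO^n belongs to X_λ. Then Σ_{i=1}^{n−1} res(u_{i,i+1} dϖ) = 0. -/

import Mathlib

open PowerSeries

noncomputable section

variable (K : Type*) [Field K]

/-- The submodule `O·e 0 ⊕ ⋯ ⊕ O·e i` of `O^n`: vectors supported on coordinates `≤ i`. -/
def coordsLE {n : ℕ} (i : Fin n) :
    Submodule (PowerSeries K) (Fin n → PowerSeries K) where
  carrier := {v | ∀ j, i < j → v j = 0}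
  zero_mem' := fun j _ => rfl
  add_mem' := fun {a b} ha hb j hj => by simp [ha j hj, hb j hj]
  smul_mem' := fun c v hv j hj => by simp [hv j hj]

/-- The lattice `R` belongs to the stratum `S_α`. -/
def MemS {n : ℕ} (α : Fin n → ℕ)
    (R : Submodule (PowerSeries K) (Fin n → PowerSeries K)) : Prop :=
  ∀ i : Fin n,
    Submodule.map (LinearMap.proj i) (R ⊓ coordsLE K i)
      = Submodule.span (PowerSeries K) {X ^ α i}

/-- `R ⊆ O^n` has finite codimension as a `K`-vector space. -/
def IsLattice {n : ℕ} (R : Submodule (PowerSeries K) (Fin n → PowerSeries K)) : Prop :=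
  FiniteDimensional K ((Fin n → PowerSeries K) ⧸ R.restrictScalars K)

/-- The lattice `R` belongs to the orbit `X_μ`, i.e. `R = g·ϖ^μ·O^n` for some `g ∈ GL_n(O)`. -/
def MemX {n : ℕ} (μ : Fin n → ℕ)
    (R : Submodule (PowerSeries K) (Fin n → PowerSeries K)) : Prop :=
  ∃ g : GL (Fin n) (PowerSeries K),
    LinearMap.range (Matrix.mulVecLin
      ((g : Matrix (Fin n) (Fin n) (PowerSeries K)) *
        Matrix.diagonal fun i => X ^ μ i)) = R

/-- `u` is upper triangular unipotent. -/
def UnipUpper {A : Type*} [CommRing A] {n : ℕ} (u : Matrix (Fin n) (Fin n) A) : Prop :=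
  (∀ i, u i i = 1) ∧ ∀ i j : Fin n, j < i → u i j = 0

/-- The image of `ϖ` in `F = K((ϖ))`. -/
def varpi : LaurentSeries K := algebraMap (PowerSeries K) (LaurentSeries K) X

/-- The `O`-lattice `g·O^n ⊆ F^n` generated by the columns of a matrix `g` over `F`. -/
def latticeOf {n : ℕ} (g : Matrix (Fin n) (Fin n) (LaurentSeries K)) :
    Submodule (PowerSeries K) (Fin n → LaurentSeries K) :=
  Submodule.span (PowerSeries K) (Set.range fun j i => g i j)

/-- `Σ_{i=1}^{n-1} res(u_{i,i+1} dϖ)`. -/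
def resSum {n : ℕ} (u : Matrix (Fin n) (Fin n) (LaurentSeries K)) : K :=
  ∑ i : Fin n, if h : (i : ℕ) + 1 < n then (u i ⟨(i : ℕ) + 1, h⟩).coeff (-1) else 0

/-- A lattice `R ⊆ F^n` belongs to `X_μ`. -/
def MemXF {n : ℕ} (μ : Fin n → ℕ)
    (R : Submodule (PowerSeries K) (Fin n → LaurentSeries K)) : Prop :=
  ∃ g : GL (Fin n) (PowerSeries K),
    R = latticeOf K
      (((g : Matrix (Fin n) (Fin n) (PowerSeries K)).map
          (algebraMap (PowerSeries K) (LaurentSeries K))) *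
        Matrix.diagonal fun i => varpi K ^ μ i)

/-- The canonical inclusion `O^n →ₗ[O] F^n`. -/
def toLaurent (n : ℕ) : (Fin n → PowerSeries K) →ₗ[PowerSeries K] (Fin n → LaurentSeries K) :=
  LinearMap.pi fun i =>
    (Algebra.linearMap (PowerSeries K) (LaurentSeries K)).comp (LinearMap.proj i)

/-- A maximal minor of `A * diagonal d * B` is divisible by any common divisor of the products of
`d` over injectively chosen indices. -/
lemma dvd_det_mul_diagonal_mul {R ι m : Type*} [CommRing R] [Fintype ι] [DecidableEq ι]
    [Fintype m] [DecidableEq m] (A : Matrix ι m R) (d : m → R) (B : Matrix m ι R) (a : R)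
    (h : ∀ f : ι → m, Function.Injective f → a ∣ ∏ j, d (f j)) :
    a ∣ (A * Matrix.diagonal d * B).det := by
  have hrows : (A * Matrix.diagonal d * B).transpose =
      fun j => ∑ k, (d k * B k j) • fun i => A i k := by
    ext j i
    rw [Matrix.transpose_apply, Matrix.mul_apply]
    simp only [Matrix.mul_diagonal, Finset.sum_apply, Pi.smul_apply, smul_eq_mul]
    exact Finset.sum_congr rfl fun _ _ => by ring
  rw [← Matrix.det_transpose, hrows]
  change a ∣ (Matrix.detRowAlternating (R := R) (n := ι)).toMultilinearMap _
  rw [MultilinearMap.map_sum]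
  refine Finset.dvd_sum fun f _ => ?_
  rw [MultilinearMap.map_smul_univ, Finset.prod_mul_distrib, smul_eq_mul]
  by_cases hf : Function.Injective f
  · exact ((h f hf).mul_right _).mul_right _
  · obtain ⟨x, y, hxy, hne⟩ : ∃ x y, f x = f y ∧ x ≠ y := by
      simpa [Function.Injective] using hf
    have h0 : (Matrix.detRowAlternating (R := R) (n := ι)) (fun j i => A i (f j)) = 0 :=
      AlternatingMap.map_eq_zero_of_eq _ _ (by simp [hxy]) hne
    change a ∣ _ * (Matrix.detRowAlternating (R := R) (n := ι)) (fun j i => A i (f j))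
    simp [h0]

/-- The final segment minimises the sum of an antitone tuple over index sets of given size. -/
lemma Antitone.sum_Ioi_le_sum_of_injective {n : ℕ} {lam : Fin n → ℕ} (hlam : Antitone lam)
    (i : Fin n) (f : {j : Fin n // i < j} → Fin n) (hf : Function.Injective f) :
    ∑ j : {j : Fin n // i < j}, lam j ≤ ∑ j, lam (f j) := by
  classical
  set S := Finset.univ.image f
  set T := Finset.Ioi i
  have hT : ∑ j : {j : Fin n // i < j}, lam j = ∑ j ∈ T, lam j :=
    (Finset.sum_subtype T (by simp [T]) lam).symm
  have hS : ∑ j, lam (f j) = ∑ j ∈ S, lam j := (Finset.sum_image hf.injOn).symm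
  have hcard : T.card = S.card := by
    rw [Finset.card_image_of_injective _ hf, Finset.card_univ]
    exact (Fintype.card_of_subtype T (by simp [T])).symm
  rw [hT, hS, ← Finset.sum_inter_add_sum_sdiff T S, ← Finset.sum_inter_add_sum_sdiff S T,
    Finset.inter_comm S T]
  gcongr _ + ?_
  calc ∑ j ∈ T \ S, lam j ≤ (T \ S).card • lam i :=
        Finset.sum_le_card_nsmul _ _ _ fun j hj => hlam (by simp [T] at hj; exact hj.1.le)
    _ = (S \ T).card • lam i := by rw [Finset.card_sdiff_comm hcard]
    _ ≤ ∑ j ∈ S \ T, lam j :=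
        Finset.card_nsmul_le_sum _ _ _ fun j hj => hlam (by simp [T] at hj; exact hj.2)

variable {K} in
/-- Generators of a lattice contained in `latticeOf K g` are integral combinations of the columns
of `g`. -/
lemma exists_eq_mul_map_of_latticeOf_le {n : ℕ} {v g : Matrix (Fin n) (Fin n) (LaurentSeries K)}
    (h : latticeOf K v ≤ latticeOf K g) :
    ∃ B : Matrix (Fin n) (Fin n) (PowerSeries K),
      v = g * B.map (algebraMap (PowerSeries K) (LaurentSeries K)) := by
  have hcol (j : Fin n) : ∃ c : Fin n → PowerSeries K, ∑ k, c k • (fun i => g i k) =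
      fun i => v i j :=
    Submodule.mem_span_range_iff_exists_fun _ |>.1 (h (Submodule.subset_span ⟨j, rfl⟩))
  choose c hc using hcol
  refine ⟨.of fun k j => c j k, ?_⟩
  ext1 i j
  rw [← congrFun (hc j) i]
  simp [Matrix.mul_apply, Algebra.smul_def, mul_comm]

variable {K} in
/-- The superdiagonal entries of `u` are integral if `u·ϖ^λ·O^n ∈ X_λ`. -/
lemma UnipUpper.superdiagonal_integral {n : ℕ} {lam : Fin n → ℕ} (hlam : Antitone lam)
    {u : Matrix (Fin n) (Fin n) (LaurentSeries K)} (hu : UnipUpper u)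
    (hX : MemXF K lam (latticeOf K (u * Matrix.diagonal fun i => varpi K ^ lam i)))
    {i i' : Fin n} (hi : (i : ℕ) + 1 = i') :
    ∃ c : PowerSeries K, algebraMap (PowerSeries K) (LaurentSeries K) c = u i i' := by
  classical
  obtain ⟨g, hg⟩ := hX
  obtain ⟨B, hB⟩ := exists_eq_mul_map_of_latticeOf_le hg.le
  set φ := algebraMap (PowerSeries K) (LaurentSeries K)
  set r : {j : Fin n // i < j} → Fin n := fun j => if (j : Fin n) = i' then i else j
  set col : {j : Fin n // i < j} → Fin n := Subtype.val
  set s := ∑ j : {j : Fin n // i < j}, lam j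
  set P : Matrix {j : Fin n // i < j} {j : Fin n // i < j} (PowerSeries K) :=
    (g : Matrix (Fin n) (Fin n) (PowerSeries K)).submatrix r id *
      Matrix.diagonal (fun i => (X : PowerSeries K) ^ lam i) * B.submatrix id col with hP
  obtain ⟨c, hc⟩ : (X : PowerSeries K) ^ s ∣ P.det := by
    refine dvd_det_mul_diagonal_mul _ _ _ _ fun f hf => ?_
    rw [Finset.prod_pow_eq_pow_sum]
    exact pow_dvd_pow _ (hlam.sum_Ioi_le_sum_of_injective i f hf)
  have hmap : φ.mapMatrix P =
      (u * Matrix.diagonal fun i => varpi K ^ lam i).submatrix r col := by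
    rw [hB, hP]
    ext1 a b
    simp [Matrix.mul_apply, Matrix.diagonal_apply, varpi, φ]
  have htri : ((u * Matrix.diagonal fun i => varpi K ^ lam i).submatrix r
      col).BlockTriangular id := by
    intro a b hab
    have hab' : (b : Fin n) < a := hab
    have hb := b.2
    have ha : (a : Fin n) ≠ i' := by
      rintro h
      rw [h] at hab'
      omega
    simp [r, col, ha, Matrix.mul_diagonal, hu.2 _ _ hab']
  have hii' : i < i' := by omega
  have hdet : φ (X ^ s * c) = u i i' * varpi K ^ s := by
    rw [← hc, RingHom.map_det, hmap, Matrix.det_of_isUpperTriangular htri]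
    simp only [Matrix.submatrix_apply, Matrix.mul_diagonal, Finset.prod_mul_distrib,
      Finset.prod_pow_eq_pow_sum]
    congr 1
    rw [Finset.prod_eq_single (⟨i', hii'⟩ : {j : Fin n // i < j})]
    · simp [r, col]
    · intro b _ hb
      have : (b : Fin n) ≠ i' := fun h => hb (Subtype.ext h)
      simp [r, col, this, hu.1]
    · simp
  have hvarpi : varpi K ^ s ≠ 0 := by
    refine pow_ne_zero _ ?_
    rw [varpi, Ne, FaithfulSMul.algebraMap_eq_zero_iff]
    exact X_ne_zero
  refine ⟨c, mul_right_cancel₀ hvarpi ?_⟩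
  rw [← hdet, map_mul, map_pow, mul_comm]
  rfl

/-- If `λ` is decreasing, `u ∈ N(F)`, and the lattice `u·ϖ^λ·O^n` belongs to
`X_λ`, then `Σ_{i=1}^{n−1} res(u_{i,i+1} dϖ) = 0`. -/
theorem stmt7 {n : ℕ} (lam : Fin n → ℕ) (hlam : Antitone lam)
    (u : Matrix (Fin n) (Fin n) (LaurentSeries K)) (hu : UnipUpper u)
    (hX : MemXF K lam
      (latticeOf K (u * Matrix.diagonal fun i => varpi K ^ lam i))) :
    resSum K u = 0 := by
  refine Finset.sum_eq_zero fun i _ => ?_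
  split_ifs with h
  · obtain ⟨c, hc⟩ := hu.superdiagonal_integral hlam hX (i := i) (i' := ⟨i + 1, h⟩) rfl
    rw [← hc]
    exact (PowerSeries.coeff_coe c (-1)).trans (by simp)
  · rfl

end
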